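/- Let ψ be a formula containing no occurrence of the operator X (so deg(ψ) = 0). Then: (a) for any nonempty finite sequences of states, satisfaction of ψ on (S_i, …, S_m) depends only on the first state S_i, so one may say 'ψ holds at state s'; and (b) for every n ∈ ℕ, a transition system with valuation globally satisfies nest(ψ, ∧, n) if and only if for every valid sequence (S_0, …, S_k) with k ≤ n, ψ holds at S_k. -/

import Mathlib

/-- Formulas of a finite-trace temporal logic over a type `α` of atoms. -/
inductive Formula (α : Type*) : Type _ where
  | atom : α → Formula α
  | and : Formula α → Formula α → Formula α
  | neg : Formula α → Formula α
  | next : Formula α → Formula α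

namespace Formula

/-- Disjunction `φ₁ ∨ φ₂` abbreviates `¬(¬φ₁ ∧ ¬φ₂)`. -/
def or {α : Type*} (f g : Formula α) : Formula α := neg (and (neg f) (neg g))

/-- The degree of a formula: maximal nesting depth of the weak-next operator. -/
def deg {α : Type*} : Formula α → ℕ
  | atom _ => 0
  | and f g => max f.deg g.deg
  | neg f => f.deg
  | next f => f.deg + 1

end Formula

/-- Satisfaction of a formula on the nonempty finite sequence `(σ i, …, σ m)`:
`Sat v σ m φ i` means `φ` holds on `(σ i, …, σ m)`. -/
def Sat {S α : Type*} (v : S → α → Prop) (σ : ℕ → S) (m : ℕ) : Formula α → ℕ → Prop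
  | .atom a, i => v (σ i) a
  | .and f g, i => Sat v σ m f i ∧ Sat v σ m g i
  | .neg f, i => ¬ Sat v σ m f i
  | .next f, i => i = m ∨ (i < m ∧ Sat v σ m f (i + 1))

/-- `nest(φ, ∨, n)`. -/
def nestOr {α : Type*} (φ : Formula α) : ℕ → Formula α
  | 0 => φ
  | n + 1 => φ.or (Formula.next (nestOr φ n))

/-- `nest(φ, ∧, n)`. -/
def nestAnd {α : Type*} (φ : Formula α) : ℕ → Formula α
  | 0 => φ
  | n + 1 => Formula.and φ (Formula.next (nestAnd φ n))

/-- A transition system: states, step relation, terminal states, initial state. -/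
structure TransSys (S : Type*) where
  R : S → S → Prop
  T : Set S
  init : S

/-- The set of blocked states: states with no successor. -/
def TransSys.B {S : Type*} (ts : TransSys S) : Set S := {s | ∀ s', ¬ ts.R s s'}

/-- `(σ 0, …, σ m)` is a valid sequence. -/
def TransSys.Valid {S : Type*} (ts : TransSys S) (σ : ℕ → S) (m : ℕ) : Prop :=
  σ 0 = ts.init ∧ (∀ i < m, ts.R (σ i) (σ (i + 1))) ∧ (∀ i < m, σ i ∉ ts.T)

/-- `(σ 0, …, σ m)` is an `n`-max valid sequence. -/
def TransSys.NMax {S : Type*} (ts : TransSys S) (n : ℕ) (σ : ℕ → S) (m : ℕ) : Prop :=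
  ts.Valid σ m ∧ (m = n ∨ (m < n ∧ σ m ∈ ts.T ∪ ts.B))

/-- The system globally satisfies `φ`: every `deg(φ)`-max valid sequence satisfies `φ`. -/
def GlobSat {S α : Type*} (ts : TransSys S) (v : S → α → Prop) (φ : Formula α) : Prop :=
  ∀ σ m, ts.NMax φ.deg σ m → Sat v σ m φ 0

/-- A formula contains no occurrence of the weak-next operator X. -/
def XFree {α : Type*} : Formula α → Prop
  | .atom _ => True
  | .and f g => XFree f ∧ XFree g
  | .neg f => XFree f
  | .next _ => False

theorem sat_first {S α : Type*} (v : S → α → Prop) (ψ : Formula α) (hψ : XFree ψ)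
    (σ σ' : ℕ → S) (i m i' m' : ℕ) (h : σ i = σ' i') :
    Sat v σ m ψ i ↔ Sat v σ' m' ψ i' := by
  induction ψ with
  | atom a => simp [Sat, h]
  | and f g ihf ihg =>
    simp only [Sat]
    rw [ihf hψ.1, ihg hψ.2]
  | neg f ih =>
    simp only [Sat]
    rw [ih hψ]
  | next f ih => exact hψ.elim

theorem deg_xfree {α : Type*} (ψ : Formula α) (hψ : XFree ψ) : ψ.deg = 0 := by
  induction ψ with
  | atom a => rfl
  | and f g ihf ihg => simp [Formula.deg, ihf hψ.1, ihg hψ.2]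
  | neg f ih => exact ih hψ
  | next f ih => exact hψ.elim

theorem deg_nestAnd {α : Type*} (ψ : Formula α) (hψ : XFree ψ) (n : ℕ) :
    (nestAnd ψ n).deg = n := by
  induction n with
  | zero => exact deg_xfree ψ hψ
  | succ n ih => simp [nestAnd, Formula.deg, ih, deg_xfree ψ hψ]

theorem sat_nestAnd {S α : Type*} (v : S → α → Prop) (ψ : Formula α)
    (σ : ℕ → S) (m n i : ℕ) (hi : i ≤ m) :
    Sat v σ m (nestAnd ψ n) i ↔ ∀ j, i ≤ j → j ≤ i + n → j ≤ m → Sat v σ m ψ j := by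
  induction n generalizing i with
  | zero =>
    simp only [nestAnd]
    constructor
    · intro h j h1 h2 _
      obtain rfl : j = i := by omega
      exact h
    · intro h
      exact h i le_rfl (by omega) hi
  | succ n ih =>
    simp only [nestAnd, Sat]
    constructor
    · rintro ⟨h0, h⟩ j h1 h2 h3
      rcases Nat.eq_or_lt_of_le h1 with rfl | h4
      · exact h0
      · rcases h with h | ⟨h5, h⟩
        · omega
        · exact (ih (i + 1) h5).1 h j h4 (by omega) h3
    · intro h
      refine ⟨h i le_rfl (by omega) hi, ?_⟩
      rcases Nat.eq_or_lt_of_le hi with h4 | h4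
      · exact Or.inl h4
      · exact Or.inr ⟨h4, (ih (i + 1) h4).2 fun j h1 h2 h3 =>
          h j (by omega) (by omega) h3⟩

theorem extend_valid {S : Type*} (ts : TransSys S) (d : ℕ) :
    ∀ (n k : ℕ) (σ : ℕ → S), k + d = n → ts.Valid σ k →
      ∃ σ' m, ts.NMax n σ' m ∧ k ≤ m ∧ ∀ j ≤ k, σ' j = σ j := by
  induction d with
  | zero =>
    intro n k σ hk hv
    exact ⟨σ, k, ⟨hv, Or.inl (by omega)⟩, le_rfl, fun _ _ => rfl⟩
  | succ d ih =>
    intro n k σ hk hv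
    by_cases hT : σ k ∈ ts.T ∪ ts.B
    · exact ⟨σ, k, ⟨hv, Or.inr ⟨by omega, hT⟩⟩, le_rfl, fun _ _ => rfl⟩
    · have h1 : σ k ∉ ts.T := fun h => hT (Or.inl h)
      have h2 : ∃ s, ts.R (σ k) s := by
        by_contra h
        exact hT (Or.inr fun s hs => h ⟨s, hs⟩)
      obtain ⟨s, hs⟩ := h2
      have e1 : ∀ j ≤ k, Function.update σ (k + 1) s j = σ j := fun j hj =>
        Function.update_of_ne (by omega) _ _
      have e2 : Function.update σ (k + 1) s (k + 1) = s := Function.update_self _ _ _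
      have hv' : ts.Valid (Function.update σ (k + 1) s) (k + 1) := by
        refine ⟨(e1 0 (Nat.zero_le _)).trans hv.1, fun i hi => ?_, fun i hi => ?_⟩
        · rw [e1 i (by omega)]
          rcases Nat.eq_or_lt_of_le (Nat.le_of_lt_succ hi) with rfl | h
          · rw [e2]
            exact hs
          · rw [e1 (i + 1) h]
            exact hv.2.1 i h
        · rw [e1 i (by omega)]
          rcases Nat.eq_or_lt_of_le (Nat.le_of_lt_succ hi) with rfl | h
          · exact h1
          · exact hv.2.2 i h
      obtain ⟨σ', m, hm, hkm, he⟩ := ih n (k + 1) _ (by omega) hv'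
      exact ⟨σ', m, hm, by omega, fun j hj => (he j (by omega)).trans (e1 j hj)⟩

/-- (a) satisfaction of an X-free formula depends only on the first
state of the sequence; (b) the system globally satisfies nest(ψ, ∧, n) iff ψ holds at
the last state of every valid sequence of at most n steps. -/
theorem stmt_12 {S α : Type*} (ts : TransSys S) (v : S → α → Prop) (ψ : Formula α)
    (hψ : XFree ψ) (n : ℕ) :
    (∀ (σ σ' : ℕ → S) (i m i' m' : ℕ), i ≤ m → i' ≤ m' → σ i = σ' i' →
        (Sat v σ m ψ i ↔ Sat v σ' m' ψ i')) ∧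
    (GlobSat ts v (nestAnd ψ n) ↔
      ∀ (σ : ℕ → S) (k : ℕ), k ≤ n → ts.Valid σ k → Sat v σ k ψ k) := by
  refine ⟨fun σ σ' i m i' m' _ _ h => sat_first v ψ hψ σ σ' i m i' m' h, ?_⟩
  unfold GlobSat
  rw [deg_nestAnd ψ hψ n]
  constructor
  · intro H σ k hk hv
    obtain ⟨σ', m, hm, hkm, he⟩ := extend_valid ts (n - k) n k σ (by omega) hv
    have h1 := (sat_nestAnd v ψ σ' m n 0 (Nat.zero_le _)).1 (H σ' m hm) k
      (Nat.zero_le _) (by omega) hkm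
    exact (sat_first v ψ hψ σ' σ k m k k (he k le_rfl)).1 h1
  · intro H σ m hm
    refine (sat_nestAnd v ψ σ m n 0 (Nat.zero_le _)).2 fun j _ h2 h3 => ?_
    have hv : ts.Valid σ j := ⟨hm.1.1, fun i hi => hm.1.2.1 i (by omega),
      fun i hi => hm.1.2.2 i (by omega)⟩
    exact (sat_first v ψ hψ σ σ j j j m rfl).1 (H σ j (by omega) hv)
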